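/- arXiv:2309.03735 — 2 statements merged into one kernel-verified Lean document; each statement's English description precedes it below -/
import Mathlib

section
/- If H1 and H2 are cross-intersecting r-uniform hypergraphs with τ*(H1 ∪ H2) = r, then max(ν*(H1), ν*(H2)) = r. -/
open Finset

variable {V : Type*} [DecidableEq V]

/-- The vertex set of a hypergraph: the union of its edges. -/
def vertsH (H : Set (Finset V)) : Set V := ⋃ e ∈ H, (e : Set V)

/-- `c` is a cover of the hypergraph `H`: it meets every edge. -/
def IsCoverH (H : Set (Finset V)) (c : Finset V) : Prop := ∀ e ∈ H, (c ∩ e).Nonempty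

/-- The covering number of `H` equals `k`. -/
def CoverNumIs (H : Set (Finset V)) (k : ℕ) : Prop :=
  (∃ c, IsCoverH H c ∧ c.card = k) ∧ ∀ c, IsCoverH H c → k ≤ c.card

/-- `Ck H k` is the set of covers of `H` of size exactly `k`. -/
def Ck (H : Set (Finset V)) (k : ℕ) : Set (Finset V) := {c | c.card = k ∧ IsCoverH H c}

/-- `H` is `r`-uniform. -/
def UniformH (H : Set (Finset V)) (r : ℕ) : Prop := ∀ e ∈ H, e.card = r

/-- Orthogonality of hypergraphs: every pair of edges meets in exactly one vertex. -/
def OrthH (A B : Set (Finset V)) : Prop := ∀ a ∈ A, ∀ b ∈ B, (a ∩ b).card = 1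

/-- An `(r,s)`-loom. -/
def IsLoom (r s : ℕ) (A B : Set (Finset V)) : Prop :=
  1 ≤ r ∧ 1 ≤ s ∧ OrthH A B ∧ UniformH A r ∧ UniformH B s ∧
    CoverNumIs A s ∧ CoverNumIs B r ∧ A = Ck B r ∧ B = Ck A s
/-- Cross-intersecting pair of hypergraphs. -/
def CrossInt (A B : Set (Finset V)) : Prop := ∀ a ∈ A, ∀ b ∈ B, (a ∩ b).Nonempty
variable [Fintype V]

/-- A fractional matching of `H`. -/
def IsFracMatching (H : Set (Finset V)) (f : Finset V → ℝ) : Prop :=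
  (∀ e, 0 ≤ f e) ∧ (∀ e, e ∉ H → f e = 0) ∧
    ∀ v : V, ∑ e ∈ Finset.univ.filter (fun e : Finset V => v ∈ e), f e ≤ 1

/-- The fractional matching number of `H` equals `x`. -/
def FracMatchNumIs (H : Set (Finset V)) (x : ℝ) : Prop :=
  (∃ f, IsFracMatching H f ∧ ∑ e : Finset V, f e = x) ∧
    ∀ f, IsFracMatching H f → ∑ e : Finset V, f e ≤ x

/-- A fractional cover of `H`. -/
def IsFracCover (H : Set (Finset V)) (g : V → ℝ) : Prop :=
  (∀ v, 0 ≤ g v) ∧ ∀ e ∈ H, 1 ≤ ∑ v ∈ e, g v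

/-- The fractional covering number of `H` equals `x`. -/
def FracCoverNumIs (H : Set (Finset V)) (x : ℝ) : Prop :=
  (∃ g, IsFracCover H g ∧ ∑ v : V, g v = x) ∧
    ∀ g, IsFracCover H g → x ≤ ∑ v : V, g v

/-- A perfect fractional matching of `H`: saturated at every vertex of `H`. -/
def IsPerfectFracMatching (H : Set (Finset V)) (f : Finset V → ℝ) : Prop :=
  IsFracMatching H f ∧
    ∀ v ∈ vertsH H, ∑ e ∈ Finset.univ.filter (fun e : Finset V => v ∈ e), f e = 1

/-- degree of a vertex under an edge weighting -/
def degH (f : Finset V → ℝ) (v : V) : ℝ :=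
  ∑ e ∈ Finset.univ.filter (fun e : Finset V => v ∈ e), f e

theorem degH_nonneg (f : Finset V → ℝ) (hf : ∀ e, 0 ≤ f e) (v : V) : 0 ≤ degH f v :=
  Finset.sum_nonneg fun e _ => hf e

theorem degH_double (f : Finset V → ℝ) (g : V → ℝ) :
    ∑ v, degH f v * g v = ∑ e, f e * ∑ v ∈ e, g v := by
  have hL : ∀ v, degH f v * g v = ∑ e : Finset V, if v ∈ e then f e * g v else 0 := by
    intro v
    rw [degH, Finset.sum_mul, Finset.sum_filter]
  have hR : ∀ e : Finset V, f e * ∑ v ∈ e, g v = ∑ v, if v ∈ e then f e * g v else 0 := by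
    intro e
    rw [Finset.mul_sum, Finset.sum_ite_mem, Finset.univ_inter]
  simp_rw [hL, hR]
  exact Finset.sum_comm

theorem weak_dual (H : Set (Finset V)) (f : Finset V → ℝ) (g : V → ℝ)
    (hf : IsFracMatching H f) (hg : IsFracCover H g) : ∑ e, f e ≤ ∑ v, g v := by
  calc ∑ e, f e ≤ ∑ e, f e * ∑ v ∈ e, g v := by
        apply Finset.sum_le_sum
        intro e _
        by_cases he : e ∈ H
        · exact le_mul_of_one_le_right (hf.1 e) (hg.2 e he)
        · simp [hf.2.1 e he]
    _ = ∑ v, degH f v * g v := (degH_double f g).symm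
    _ ≤ ∑ v, g v := by
        apply Finset.sum_le_sum
        intro v _
        exact mul_le_of_le_one_left (hg.1 v) (hf.2.2 v)

theorem cross_deg (A B : Set (Finset V)) (hx : CrossInt A B) (f : Finset V → ℝ)
    (hf : ∀ e, 0 ≤ f e) (hB : ∀ e, e ∉ B → f e = 0) (a : Finset V) (ha : a ∈ A) :
    ∑ e, f e ≤ ∑ v ∈ a, degH f v := by
  have h := degH_double f (fun v => if v ∈ a then (1 : ℝ) else 0)
  have h' : ∑ v, degH f v * (if v ∈ a then (1 : ℝ) else 0) = ∑ v ∈ a, degH f v := by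
    simp
  rw [← h', h]
  apply Finset.sum_le_sum
  intro e _
  by_cases he : e ∈ B
  · apply le_mul_of_one_le_right (hf e)
    obtain ⟨w, hw⟩ := hx a ha e he
    rw [Finset.mem_inter] at hw
    have := Finset.single_le_sum (f := fun v => if v ∈ a then (1 : ℝ) else 0)
      (fun i _ => by split_ifs <;> norm_num) hw.2
    simpa [hw.1] using this
  · simp [hB e he]

theorem deg_total (A : Set (Finset V)) (r : ℕ) (hA : UniformH A r) (f : Finset V → ℝ)
    (h0 : ∀ e, e ∉ A → f e = 0) : ∑ v, degH f v = r * ∑ e, f e := by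
  have h := degH_double f (fun _ => (1 : ℝ))
  simp only [mul_one] at h
  rw [h, Finset.mul_sum]
  apply Finset.sum_congr rfl
  intro e _
  by_cases he : e ∈ A
  · simp [hA e he, mul_comm]
  · simp [h0 e he]

theorem prod_ge (A B : Set (Finset V)) (hx : CrossInt A B) (f1 f2 : Finset V → ℝ)
    (hf1 : ∀ e, 0 ≤ f1 e) (hA : ∀ e, e ∉ A → f1 e = 0)
    (hf2 : ∀ e, 0 ≤ f2 e) (hB : ∀ e, e ∉ B → f2 e = 0) :
    (∑ e, f1 e) * (∑ e, f2 e) ≤ ∑ v, degH f1 v * degH f2 v := by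
  rw [degH_double, Finset.sum_mul]
  apply Finset.sum_le_sum
  intro e _
  by_cases he : e ∈ A
  · exact mul_le_mul_of_nonneg_left (cross_deg A B hx f2 hf2 hB e he) (hf1 e)
  · simp [hA e he]

theorem degH_smul (c : ℝ) (f : Finset V → ℝ) (v : V) :
    degH (fun e => c * f e) v = c * degH f v := by
  simp [degH, Finset.mul_sum]

theorem core (r : ℕ) (hr : 0 < r) (A B : Set (Finset V)) (hUA : UniformH A r)
    (hUB : UniformH B r) (hx : CrossInt A B) (f1 f2 : Finset V → ℝ)
    (hf1 : ∀ e, 0 ≤ f1 e) (hA : ∀ e, e ∉ A → f1 e = 0)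
    (hf2 : ∀ e, 0 ≤ f2 e) (hB : ∀ e, e ∉ B → f2 e = 0)
    (hd : ∀ v, degH f1 v + degH f2 v ≤ 1) (hs : ∑ e, f1 e + ∑ e, f2 e = r) :
    (∃ f, IsFracMatching A f ∧ ∑ e, f e = r) ∨ (∃ f, IsFracMatching B f ∧ ∑ e, f e = r) := by
  have hr' : (0 : ℝ) < r := by exact_mod_cast hr
  have d1 := degH_nonneg f1 hf1
  have d2 := degH_nonneg f2 hf2
  have P := prod_ge A B hx f1 f2 hf1 hA hf2 hB
  have T1 := deg_total A r hUA f1 hA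
  have T2 := deg_total B r hUB f2 hB
  have a0 : 0 ≤ ∑ e, f1 e := Finset.sum_nonneg fun e _ => hf1 e
  have b0 : 0 ≤ ∑ e, f2 e := Finset.sum_nonneg fun e _ => hf2 e
  generalize hα : ∑ e, f1 e = α at *
  generalize hβ : ∑ e, f2 e = β at *
  rcases a0.eq_or_lt with ha | ha
  · right
    refine ⟨f2, ⟨hf2, hB, fun v => ?_⟩, by linarith⟩
    have := hd v
    have := d1 v
    change degH f2 v ≤ 1
    linarith
  have S1 : ∑ v, degH f1 v * degH f1 v ≤ α ^ 2 := by
    have : ∑ v, degH f1 v * degH f1 v ≤ ∑ v, (degH f1 v - degH f1 v * degH f2 v) := by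
      apply Finset.sum_le_sum
      intro v _
      nlinarith [d1 v, hd v]
    rw [Finset.sum_sub_distrib, T1] at this
    nlinarith
  have S2 : ∑ v, degH f2 v * degH f2 v ≤ β ^ 2 := by
    have : ∑ v, degH f2 v * degH f2 v ≤ ∑ v, (degH f2 v - degH f1 v * degH f2 v) := by
      apply Finset.sum_le_sum
      intro v _
      nlinarith [d2 v, hd v]
    rw [Finset.sum_sub_distrib, T2] at this
    nlinarith
  have Z : ∑ v, (β * degH f1 v - α * degH f2 v) ^ 2 ≤ 0 := by
    have : ∑ v, (β * degH f1 v - α * degH f2 v) ^ 2 =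
        β ^ 2 * ∑ v, degH f1 v * degH f1 v - 2 * (α * β) * ∑ v, degH f1 v * degH f2 v
          + α ^ 2 * ∑ v, degH f2 v * degH f2 v := by
      simp only [Finset.mul_sum]
      rw [← Finset.sum_sub_distrib, ← Finset.sum_add_distrib]
      apply Finset.sum_congr rfl
      intro v _
      ring
    rw [this]
    have e1 := mul_le_mul_of_nonneg_left S1 (sq_nonneg β)
    have e2 := mul_le_mul_of_nonneg_left S2 (sq_nonneg α)
    have e3 := mul_le_mul_of_nonneg_left P (mul_nonneg ha.le b0)
    nlinarith
  have Zv : ∀ v, β * degH f1 v = α * degH f2 v := by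
    intro v
    have h1 := (Finset.single_le_sum (f := fun v => (β * degH f1 v - α * degH f2 v) ^ 2)
      (fun i _ => sq_nonneg _) (Finset.mem_univ v)).trans Z
    have h2 : β * degH f1 v - α * degH f2 v = 0 := by
      apply pow_eq_zero_iff (two_ne_zero) |>.1
      exact le_antisymm h1 (sq_nonneg _)
    linarith
  left
  refine ⟨fun e => (r / α) * f1 e, ⟨fun e => mul_nonneg (by positivity) (hf1 e),
    fun e he => by simp [hA e he], fun v => ?_⟩, ?_⟩
  · change degH (fun e => (r / α) * f1 e) v ≤ 1
    rw [degH_smul, div_mul_eq_mul_div, div_le_one ha, ← hs, add_mul, Zv v, ← mul_add]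
    exact mul_le_of_le_one_right ha.le (hd v)
  · rw [← Finset.mul_sum, hα]
    field_simp

/-- strong duality, in the form needed -/
theorem strong_dual (r : ℕ) (hr : 0 < r) (H : Set (Finset V))
    (h : ∀ g, IsFracCover H g → (r : ℝ) ≤ ∑ v, g v) :
    ∃ f, IsFracMatching H f ∧ ∑ e, f e = r := by
  have hr' : (0 : ℝ) < r := by exact_mod_cast hr
  let L : (Finset V → ℝ) →ₗ[ℝ] (V → ℝ) :=
    { toFun := fun f v => degH f v
      map_add' := by
        intro f g
        ext v
        simp [degH, Finset.sum_add_distrib]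
      map_smul' := by
        intro c f
        ext v
        simp [degH, Finset.mul_sum] }
  let S : Set (Finset V → ℝ) := (fun e => Pi.single e (1 : ℝ)) '' H
  have hSf : S.Finite := (Set.toFinite H).image _
  let K : Set (V → ℝ) := L '' convexHull ℝ S
  have hKc : IsCompact K := (hSf.isCompact_convexHull (𝕜 := ℝ)).image L.continuous_of_finiteDimensional
  have hKv : Convex ℝ K := (convex_convexHull ℝ S).linear_image L
  let T : Set (V → ℝ) := Set.Iic (fun _ => 1 / (r : ℝ))
  by_cases hdis : Disjoint T K
  · exfalso
    obtain ⟨φ, u, w, hT, huw, hK⟩ :=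
      geometric_hahn_banach_closed_compact (convex_Iic _) isClosed_Iic hKv hKc hdis
    have hφ : ∀ x : V → ℝ, φ x = ∑ v, x v * φ (Pi.single v 1) := by
      intro x
      conv_lhs => rw [pi_eq_sum_univ' x]
      simp [map_sum]
    have hu : 0 < u := by
      have := hT 0 (by intro v; simp)
      simpa using this
    have hnn : ∀ v, 0 ≤ φ (Pi.single v 1) := by
      intro v
      by_contra! hneg
      have := hT ((u / φ (Pi.single v 1)) • Pi.single v 1) (by
        intro z
        have h1 : u / φ (Pi.single v 1) ≤ 0 := (div_neg_of_pos_of_neg hu hneg).le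
        have h2 : (0 : ℝ) ≤ 1 / r := by positivity
        by_cases hz : z = v
        · subst hz
          simpa using h1.trans h2
        · simp [hz])
      rw [map_smul, smul_eq_mul, div_mul_cancel₀ _ hneg.ne] at this
      exact lt_irrefl _ this
    have hcov : IsFracCover H (fun v => φ (Pi.single v 1) / u) := by
      refine ⟨fun v => div_nonneg (hnn v) hu.le, fun e he => ?_⟩
      have h1 := hK (L (Pi.single e 1)) ⟨_, subset_convexHull ℝ S ⟨e, he, rfl⟩, rfl⟩
      rw [hφ] at h1
      change w < ∑ v, degH (Pi.single e 1) v * _ at h1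
      rw [degH_double] at h1
      have h2 : ∑ e' : Finset V, (Pi.single e (1 : ℝ) : Finset V → ℝ) e' *
          ∑ v ∈ e', φ (Pi.single v 1) = ∑ v ∈ e, φ (Pi.single v 1) := by
        rw [Finset.sum_eq_single e]
        · simp
        · intro b _ hb
          simp [hb]
        · simp
      rw [h2] at h1
      rw [← Finset.sum_div, le_div_iff₀ hu]
      linarith
    have h1 := h _ hcov
    rw [← Finset.sum_div, le_div_iff₀ hu] at h1
    have h2 := hT (fun _ => 1 / (r : ℝ)) (Set.mem_Iic.2 le_rfl)
    rw [hφ, ← Finset.mul_sum, one_div_mul_eq_div, div_lt_iff₀ hr'] at h2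
    linarith
  · rw [Set.not_disjoint_iff] at hdis
    obtain ⟨x, hxT, f, hf, rfl⟩ := hdis
    have hsub : convexHull ℝ S ⊆
        {f | (∀ e, 0 ≤ f e) ∧ (∀ e, e ∉ H → f e = 0) ∧ ∑ e, f e = 1} := by
      apply convexHull_min
      · rintro _ ⟨e, he, rfl⟩
        refine ⟨fun e' => ?_, fun e' he' => ?_, ?_⟩
        · by_cases hz : e' = e
          · subst hz; simp
          · simp [hz]
        · have : e' ≠ e := fun hh => he' (hh ▸ he)
          simp [this]
        · simp
      · rintro f ⟨p1, p2, p3⟩ g ⟨q1, q2, q3⟩ a b ha hb hab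
        refine ⟨fun e => ?_, fun e he => ?_, ?_⟩
        · exact add_nonneg (mul_nonneg ha (p1 e)) (mul_nonneg hb (q1 e))
        · simp [p2 e he, q2 e he]
        · simp [Finset.sum_add_distrib, ← Finset.mul_sum, p3, q3, hab]
    obtain ⟨p1, p2, p3⟩ := hsub hf
    refine ⟨fun e => r * f e, ⟨fun e => mul_nonneg hr'.le (p1 e),
      fun e he => by simp [p2 e he], fun v => ?_⟩, ?_⟩
    · change degH (fun e => r * f e) v ≤ 1
      have := hxT v
      change degH f v ≤ 1 / (r : ℝ) at this
      rw [le_div_iff₀ hr'] at this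
      rw [degH_smul]
      linarith
    · rw [← Finset.mul_sum, p3, mul_one]

/-- if `H1, H2` are cross-intersecting `r`-uniform hypergraphs with
`τ*(H1 ∪ H2) = r`, then `max(ν*(H1), ν*(H2)) = r`. -/
theorem stmt7 (r : ℕ) (H1 H2 : Set (Finset V))
    (h1 : UniformH H1 r) (h2 : UniformH H2 r) (hx : CrossInt H1 H2)
    (ht : FracCoverNumIs (H1 ∪ H2) (r : ℝ))
    (n1 n2 : ℝ) (hn1 : FracMatchNumIs H1 n1) (hn2 : FracMatchNumIs H2 n2) :
    max n1 n2 = (r : ℝ) := by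
  classical
  obtain ⟨⟨g, hg, hgs⟩, hmin⟩ := ht
  obtain ⟨⟨f1, hf1, hs1⟩, hm1⟩ := hn1
  obtain ⟨⟨f2, hf2, hs2⟩, hm2⟩ := hn2
  have u1 : n1 ≤ r := by
    rw [← hs1, ← hgs]
    exact weak_dual H1 f1 g hf1 ⟨hg.1, fun e he => hg.2 e (Or.inl he)⟩
  have u2 : n2 ≤ r := by
    rw [← hs2, ← hgs]
    exact weak_dual H2 f2 g hf2 ⟨hg.1, fun e he => hg.2 e (Or.inr he)⟩
  apply le_antisymm (max_le u1 u2)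
  rw [le_max_iff]
  rcases Nat.eq_zero_or_pos r with hr | hr
  · left
    rw [hr, ← hs1, Nat.cast_zero]
    exact Finset.sum_nonneg fun e _ => hf1.1 e
  obtain ⟨f, hf, hfs⟩ := strong_dual r hr (H1 ∪ H2) hmin
  have hadd : ∀ e, (if e ∈ H1 then f e else 0) + (if e ∈ H1 then 0 else f e) = f e := by
    intro e
    split_ifs <;> simp
  have key := core r hr H1 H2 h1 h2 hx (fun e => if e ∈ H1 then f e else 0)
    (fun e => if e ∈ H1 then 0 else f e)
    (fun e => by split_ifs; exacts [hf.1 e, le_rfl])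
    (fun e he => by simp [he])
    (fun e => by split_ifs; exacts [le_rfl, hf.1 e])
    (fun e he => by
      by_cases h : e ∈ H1
      · simp [h]
      · simpa [h] using hf.2.1 e (by simp [h, he]))
    (fun v => by
      simp only [degH]
      rw [← Finset.sum_add_distrib]
      simp only [hadd]
      exact hf.2.2 v)
    (by
      rw [← Finset.sum_add_distrib]
      simp only [hadd]
      exact hfs)
  rcases key with ⟨k, hk, hks⟩ | ⟨k, hk, hks⟩
  · left
    rw [← hks]
    exact hm1 k hk
  · right
    rw [← hks]
    exact hm2 k hk
end

section
/- Let G be an s-regular graph on an even number of vertices and A = PM(G) the hypergraph of perfect matchings on ground set E(G). If τ(A) ≥ s − 1, then ν*(A) = s. -/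
open Finset

variable {V : Type*} [DecidableEq V]

variable [Fintype V]

/-- The perfect matchings of a graph `G`, as sets of edges of `G`. -/
def PMG {W : Type*} (G : SimpleGraph W) : Set (Finset (Sym2 W)) :=
  {M | (↑M ⊆ G.edgeSet) ∧ ∀ v : W, ∃! e, e ∈ M ∧ v ∈ e}

/-- matching -/
def IsMt {W : Type*} (M : Finset (Sym2 W)) : Prop :=
  ∀ e ∈ M, ∀ e' ∈ M, ∀ v, v ∈ e → v ∈ e' → e = e'

/-- covered vertex -/
def CovV {W : Type*} (M : Finset (Sym2 W)) (v : W) : Prop := ∃ e ∈ M, v ∈ e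

lemma IsMt.subset {W : Type*} {M N : Finset (Sym2 W)} (h : IsMt N) (hs : M ⊆ N) : IsMt M :=
  fun e he e' he' v h1 h2 => h e (hs he) e' (hs he') v h1 h2

lemma two_card_le {W : Type*} [DecidableEq W] (Q : Finset (Sym2 W)) (hQ : IsMt Q)
    (nl : ∀ e ∈ Q, ¬ e.IsDiag) (C : Finset W) (h : ∀ e ∈ Q, ∀ x ∈ e, x ∈ C) :
    2 * #Q ≤ #C := by
  have h1 : #(Q.biUnion Sym2.toFinset) = ∑ e ∈ Q, #e.toFinset := by
    apply Finset.card_biUnion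
    intro e he e' he' hne
    rw [Function.onFun, Finset.disjoint_left]
    intro v hv hv'
    exact hne (hQ e he e' he' v (Sym2.mem_toFinset.1 hv) (Sym2.mem_toFinset.1 hv'))
  have h2 : ∑ e ∈ Q, #e.toFinset = ∑ e ∈ Q, 2 :=
    Finset.sum_congr rfl fun e he => Sym2.card_toFinset_of_not_isDiag e (nl e he)
  have h3 : #(Q.biUnion Sym2.toFinset) ≤ #C := by
    apply Finset.card_le_card
    intro v hv
    obtain ⟨e, he, hv⟩ := Finset.mem_biUnion.1 hv
    exact h e he v (Sym2.mem_toFinset.1 hv)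
  rw [h1, h2] at h3
  simp at h3
  omega

lemma exists_comp {W : Type*} [Fintype W] [DecidableEq W] (D : Finset (Sym2 W))
    (K : Finset W) (t : W) (ht : t ∈ K)
    (hK : ∀ e ∈ D, ∀ x ∈ e, x ∈ K → e.toFinset ⊆ K) :
    ∃ C : Finset W, t ∈ C ∧ C ⊆ K ∧ #C ≤ #(D.filter (fun e => e.toFinset ⊆ C)) + 1 ∧
      ∀ e ∈ D, ∀ x ∈ e, x ∈ C → e.toFinset ⊆ C := by
  obtain ⟨C, hC, hmax⟩ := Finset.exists_max_image
    ((Finset.univ : Finset (Finset W)).filter (fun C => t ∈ C ∧ C ⊆ K ∧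
      #C ≤ #(D.filter (fun e => e.toFinset ⊆ C)) + 1)) Finset.card
    ⟨{t}, by simp [ht]⟩
  simp only [mem_filter, mem_univ, true_and] at hC hmax
  obtain ⟨h1, h2, h3⟩ := hC
  refine ⟨C, h1, h2, h3, ?_⟩
  intro e he x hx hxC y hy
  by_contra hyC
  have heK := hK e he x hx (h2 hxC)
  have hxy : e = s(x, y) := by
    have hne : x ≠ y := fun h => hyC (h ▸ hxC)
    exact ((Sym2.mem_and_mem_iff hne).1 ⟨hx, Sym2.mem_toFinset.1 hy⟩)
  have := hmax (insert y C) ⟨by simp [h1], by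
      intro z hz
      rcases Finset.mem_insert.1 hz with rfl | hz
      · exact heK hy
      · exact h2 hz, by
      rw [Finset.card_insert_of_notMem hyC]
      have : insert e (D.filter (fun e => e.toFinset ⊆ C)) ⊆
          D.filter (fun e => e.toFinset ⊆ insert y C) := by
        intro f hf
        rcases Finset.mem_insert.1 hf with rfl | hf
        · rw [mem_filter]
          refine ⟨he, ?_⟩
          intro z hz
          rw [Sym2.mem_toFinset, hxy, Sym2.mem_iff] at hz
          rcases hz with rfl | rfl <;> simp [hxC]
        · rw [mem_filter] at hf ⊢
          exact ⟨hf.1, hf.2.trans (Finset.subset_insert _ _)⟩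
      have h5 := Finset.card_le_card this
      rw [Finset.card_insert_of_notMem (by
        rw [mem_filter]; exact fun h => hyC (h.2 hy))] at h5
      omega⟩
  rw [Finset.card_insert_of_notMem hyC] at this
  omega

lemma mt_swap {W : Type*} [DecidableEq W] (M N : Finset (Sym2 W)) (hM : IsMt M)
    (hN : IsMt N) (C : Finset W)
    (hcl : ∀ e ∈ (M \ N) ∪ (N \ M), ∀ x ∈ e, x ∈ C → e.toFinset ⊆ C)
    (P : Finset (Sym2 W)) (hP : P = ((M \ N) ∪ (N \ M)).filter (fun e => e.toFinset ⊆ C)) :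
    IsMt ((M \ P) ∪ (N ∩ P)) := by
  have key : ∀ e ∈ M \ P, ∀ f ∈ N ∩ P, ∀ v, v ∈ e → v ∈ f → e = f := by
    intro e he f hf v hve hvf
    rw [mem_sdiff] at he
    rw [mem_inter] at hf
    have hf2 := hf.2
    rw [hP, mem_filter] at hf2
    have hvC := hf2.2 (Sym2.mem_toFinset.2 hvf)
    by_cases heN : e ∈ N
    · exact hN e heN f hf.1 v hve hvf
    · exfalso
      apply he.2
      have heD : e ∈ (M \ N) ∪ (N \ M) := by simp [he.1, heN]
      rw [hP, mem_filter]
      exact ⟨heD, hcl e heD v hve hvC⟩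
  intro e he f hf v hve hvf
  rcases mem_union.1 he with he | he <;> rcases mem_union.1 hf with hf | hf
  · exact hM e (mem_sdiff.1 he).1 f (mem_sdiff.1 hf).1 v hve hvf
  · exact key e he f hf v hve hvf
  · exact (key f hf e he v hvf hve).symm
  · exact hN e (mem_inter.1 he).1 f (mem_inter.1 hf).1 v hve hvf

lemma swap_main {W : Type*} [Fintype W] [DecidableEq W] (M N : Finset (Sym2 W)) (hM : IsMt M)
    (hN : IsMt N) (nl : ∀ e ∈ M ∪ N, ¬ e.IsDiag) (t u v : W) (huv : u ≠ v)
    (hNt : ¬ CovV N t) (hMu : ¬ CovV M u) (hMv : ¬ CovV M v)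
    (K : Finset W) (htK : t ∈ K)
    (hK : ∀ e ∈ M ∪ N, ∀ x ∈ e, x ∈ K → e.toFinset ⊆ K) :
    ∃ M' N' : Finset (Sym2 W), IsMt M' ∧ IsMt N' ∧ M' ⊆ M ∪ N ∧ N' ⊆ M ∪ N ∧
      (∀ g : Sym2 W → ℕ, ∑ e ∈ M', g e + ∑ e ∈ N', g e = ∑ e ∈ M, g e + ∑ e ∈ N, g e) ∧
      #(M'.filter (fun e => e.toFinset ⊆ K)) ≤ #(M.filter (fun e => e.toFinset ⊆ K)) ∧
      ¬ CovV M' t ∧ (¬ CovV M' u ∨ ¬ CovV M' v) := by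
  have hDsub : (M \ N) ∪ (N \ M) ⊆ M ∪ N := by
    intro e; simp only [mem_union, mem_sdiff]; tauto
  obtain ⟨C, htC, hCK, hcard, hcl⟩ := exists_comp ((M \ N) ∪ (N \ M)) K t htK
    (fun e he => hK e (hDsub he))
  obtain ⟨P, hP⟩ : ∃ P, P = ((M \ N) ∪ (N \ M)).filter (fun e => e.toFinset ⊆ C) := ⟨_, rfl⟩
  rw [← hP] at hcard
  have hPC : ∀ e ∈ P, e.toFinset ⊆ C := by
    intro e he; rw [hP, mem_filter] at he; exact he.2
  have hPx : ∀ e ∈ P, (e ∈ M ∧ e ∉ N) ∨ (e ∈ N ∧ e ∉ M) := by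
    intro e he; rw [hP, mem_filter] at he; simpa using he.1
  have hPcard : #P = #(M ∩ P) + #(N ∩ P) := by
    rw [← Finset.card_union_of_disjoint]
    · congr 1
      ext e
      have := hPx e
      simp only [mem_union, mem_inter]; tauto
    · rw [Finset.disjoint_left]
      intro e
      have := hPx e
      simp only [mem_inter]; tauto
  have hNP : 2 * #(N ∩ P) ≤ #(C.erase t) := by
    apply two_card_le _ (hN.subset inter_subset_left)
    · intro e he; exact nl e (mem_union_right _ (mem_inter.1 he).1)
    · intro e he x hx
      rw [mem_erase]
      refine ⟨?_, hPC e (mem_inter.1 he).2 (Sym2.mem_toFinset.2 hx)⟩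
      rintro rfl
      exact hNt ⟨e, (mem_inter.1 he).1, hx⟩
  rw [Finset.card_erase_of_mem htC] at hNP
  have hCpos : 0 < #C := Finset.card_pos.2 ⟨t, htC⟩
  have hcl2 : ∀ e ∈ (N \ M) ∪ (M \ N), ∀ x ∈ e, x ∈ C → e.toFinset ⊆ C := by
    intro e he; exact hcl e (by rwa [union_comm] at he)
  have hdM : Disjoint (M \ P) (N ∩ P) := by
    rw [Finset.disjoint_left]; intro e; simp only [mem_sdiff, mem_inter]; tauto
  have hdN : Disjoint (N \ P) (M ∩ P) := by
    rw [Finset.disjoint_left]; intro e; simp only [mem_sdiff, mem_inter]; tauto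
  refine ⟨(M \ P) ∪ (N ∩ P), (N \ P) ∪ (M ∩ P), mt_swap M N hM hN C hcl P hP,
    mt_swap N M hN hM C hcl2 P (by rw [hP, union_comm]), ?_, ?_, ?_, ?_, ?_, ?_⟩
  · intro e; simp only [mem_union, mem_sdiff, mem_inter]; tauto
  · intro e; simp only [mem_union, mem_sdiff, mem_inter]; tauto
  · intro g
    rw [Finset.sum_union hdM, Finset.sum_union hdN]
    have h1 := Finset.sum_inter_add_sum_sdiff M P g
    have h2 := Finset.sum_inter_add_sum_sdiff N P g
    omega
  · have h1 : #(((M \ P) ∪ (N ∩ P)).filter (fun e => e.toFinset ⊆ K)) ≤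
        #((M \ P).filter (fun e => e.toFinset ⊆ K)) + #(N ∩ P) := by
      rw [Finset.filter_union]
      refine (Finset.card_union_le _ _).trans ?_
      gcongr
      exact filter_subset _ _
    have h2 : #((M \ P).filter (fun e => e.toFinset ⊆ K)) + #(M ∩ P) ≤
        #(M.filter (fun e => e.toFinset ⊆ K)) := by
      rw [← Finset.card_union_of_disjoint]
      · apply Finset.card_le_card
        intro e he
        rcases mem_union.1 he with he | he
        · simp only [mem_filter, mem_sdiff] at he ⊢; tauto
        · rw [mem_inter] at he
          rw [mem_filter]
          exact ⟨he.1, (hPC e he.2).trans hCK⟩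
      · rw [Finset.disjoint_left]; intro e
        simp only [mem_filter, mem_sdiff, mem_inter]; tauto
    omega
  · rintro ⟨e, he, hte⟩
    rcases mem_union.1 he with he | he
    · rw [mem_sdiff] at he
      have heN : e ∉ N := fun h => hNt ⟨e, h, hte⟩
      have heD : e ∈ (M \ N) ∪ (N \ M) := by simp [he.1, heN]
      apply he.2
      rw [hP, mem_filter]
      exact ⟨heD, hcl e heD t hte htC⟩
    · exact hNt ⟨e, (mem_inter.1 he).1, hte⟩
  · have hmiss : ∀ z, ¬ CovV M z → z ∉ C → ¬ CovV ((M \ P) ∪ (N ∩ P)) z := by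
      rintro z hz hzC ⟨e, he, hze⟩
      rcases mem_union.1 he with he | he
      · exact hz ⟨e, (mem_sdiff.1 he).1, hze⟩
      · exact hzC (hPC e (mem_inter.1 he).2 (Sym2.mem_toFinset.2 hze))
    by_cases huC : u ∈ C
    · by_cases hvC : v ∈ C
      · exfalso
        have hMP : 2 * #(M ∩ P) ≤ #((C.erase u).erase v) := by
          apply two_card_le _ (hM.subset inter_subset_left)
          · intro e he; exact nl e (mem_union_left _ (mem_inter.1 he).1)
          · intro e he x hx
            rw [mem_erase, mem_erase]
            refine ⟨?_, ?_, hPC e (mem_inter.1 he).2 (Sym2.mem_toFinset.2 hx)⟩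
            · rintro rfl
              exact hMv ⟨e, (mem_inter.1 he).1, hx⟩
            · rintro rfl
              exact hMu ⟨e, (mem_inter.1 he).1, hx⟩
        have hv' : v ∈ C.erase u := mem_erase.2 ⟨huv.symm, hvC⟩
        have := Finset.card_pos.2 ⟨v, hv'⟩
        rw [Finset.card_erase_of_mem hv'] at hMP
        rw [Finset.card_erase_of_mem huC] at hMP this
        omega
      · exact Or.inr (hmiss v hMv hvC)
    · exact Or.inl (hmiss u hMu huC)

/-- reduced weight -/
def redw {W : Type*} [DecidableEq W] (w : Sym2 W → ℕ) (K : Finset W) (e : Sym2 W) : ℕ :=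
  if e.toFinset ⊆ K then w e - 1 else w e

lemma redw_sum {W : Type*} [DecidableEq W] (w : Sym2 W → ℕ) (K : Finset W)
    (M : Finset (Sym2 W)) (hM : ∀ e ∈ M, 0 < w e) :
    ∑ e ∈ M, w e = ∑ e ∈ M, redw w K e + #(M.filter (fun e => e.toFinset ⊆ K)) := by
  rw [Finset.card_filter, ← Finset.sum_add_distrib]
  apply Finset.sum_congr rfl
  intro e he
  have := hM e he
  unfold redw
  split_ifs <;> omega

/-- lexicographically optimal matchings -/
def OptM {W : Type*} [DecidableEq W] (F : Finset (Sym2 W)) (w : Sym2 W → ℕ) (K : Finset W)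
    (M : Finset (Sym2 W)) : Prop :=
  M ⊆ F ∧ IsMt M ∧ ∀ Q ⊆ F, IsMt Q → ∑ e ∈ Q, redw w K e ≤ ∑ e ∈ M, redw w K e ∧
    (∑ e ∈ Q, redw w K e = ∑ e ∈ M, redw w K e →
      #(Q.filter (fun e => e.toFinset ⊆ K)) ≤ #(M.filter (fun e => e.toFinset ⊆ K)))

lemma exists_optM {W : Type*} [DecidableEq W] (F : Finset (Sym2 W)) (w : Sym2 W → ℕ)
    (K : Finset W) : ∃ M, OptM F w K M := by
  classical
  obtain ⟨M, hM, hmax⟩ := Finset.exists_max_image (F.powerset.filter IsMt)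
    (fun M : Finset (Sym2 W) =>
      toLex (∑ e ∈ M, redw w K e, #(M.filter (fun e : Sym2 W => e.toFinset ⊆ K))))
    ⟨∅, by simp [IsMt]⟩
  simp only [mem_filter, mem_powerset, Prod.Lex.toLex_le_toLex] at hM hmax
  refine ⟨M, hM.1, hM.2, fun Q h1 h2 => ?_⟩
  have := hmax Q ⟨h1, h2⟩
  omega

lemma OptM.no_edge {W : Type*} [DecidableEq W] {F : Finset (Sym2 W)} {w : Sym2 W → ℕ}
    {K : Finset W} {M : Finset (Sym2 W)} (h : OptM F w K M)
    {u t : W} (hut : s(u, t) ∈ F) (hK : (s(u, t)).toFinset ⊆ K)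
    (hu : ¬ CovV M u) (ht : ¬ CovV M t) : False := by
  have hn : s(u, t) ∉ M := fun h => hu ⟨_, h, by simp⟩
  have hmt : IsMt (insert s(u, t) M) := by
    have key : ∀ e ∈ M, ∀ v, v ∈ e → v ∈ s(u, t) → False := by
      intro e he v hv hv'
      rcases Sym2.mem_iff.1 hv' with rfl | rfl
      · exact hu ⟨e, he, hv⟩
      · exact ht ⟨e, he, hv⟩
    intro e he f hf v hve hvf
    rcases mem_insert.1 he with rfl | he <;> rcases mem_insert.1 hf with rfl | hf
    · rfl
    · exact (key f hf v hvf hve).elim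
    · exact (key e he v hve hvf).elim
    · exact h.2.1 e he f hf v hve hvf
  have h1 := h.2.2 (insert s(u, t) M) (insert_subset hut h.1) hmt
  rw [Finset.sum_insert hn, Finset.filter_insert, if_pos hK,
    Finset.card_insert_of_notMem (fun h => hn (mem_filter.1 h).1)] at h1
  omega

lemma no_two {W : Type*} [Fintype W] [DecidableEq W] (F : Finset (Sym2 W)) (w : Sym2 W → ℕ)
    (hw : ∀ e ∈ F, 0 < w e) (nl : ∀ e ∈ F, ¬ e.IsDiag) (K : Finset W)
    (hK : ∀ e ∈ F, ∀ x ∈ e, x ∈ K → e.toFinset ⊆ K)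
    (hN : ∀ t, ∃ N ⊆ F, IsMt N ∧ (∀ Q ⊆ F, IsMt Q → ∑ e ∈ Q, w e ≤ ∑ e ∈ N, w e) ∧ ¬ CovV N t)
    (u v : W) (huv : Relation.ReflTransGen (fun x y => s(x, y) ∈ F) u v) :
    ∀ M, OptM F w K M → u ∈ K → u ≠ v → ¬ CovV M u → ¬ CovV M v → False := by
  induction huv using Relation.ReflTransGen.head_induction_on with
  | refl => intro M _ _ h; exact absurd rfl h
  | @head u t hut _ ih =>
    intro M hM huK hne hMu hMv
    have hutK := hK _ hut u (by simp) huK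
    have htK : t ∈ K := hutK (by simp)
    by_cases hMt : CovV M t
    swap
    · exact hM.no_edge hut hutK hMu hMt
    have htv : t ≠ v := fun h => hMv (h ▸ hMt)
    obtain ⟨N, hNF, hNm, hNmax, hNt⟩ := hN t
    have hun : M ∪ N ⊆ F := union_subset hM.1 hNF
    obtain ⟨M', N', hM', hN', hM's, hN's, hsum, hcard, hM't, hor⟩ :=
      swap_main M N hM.2.1 hNm (fun e he => nl e (hun he)) t u v hne hNt hMu hMv K htK
        (fun e he => hK e (hun he))
    have hM'F := hM's.trans hun
    have h1 := hsum w
    have h2 := hNmax N' (hN's.trans hun) hN'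
    have h3 := redw_sum w K M (fun e he => hw e (hM.1 he))
    have h4 := redw_sum w K M' (fun e he => hw e (hM'F he))
    have h5 := hM.2.2 M' hM'F hM'
    have hopt : OptM F w K M' := by
      refine ⟨hM'F, hM', fun Q hQ hQm => ?_⟩
      have h6 := hM.2.2 Q hQ hQm
      omega
    rcases hor with h | h
    · exact hopt.no_edge hut hutK h hM't
    · exact ih M' hopt htK htv hM't h

lemma optM_card {W : Type*} [Fintype W] [DecidableEq W] (F : Finset (Sym2 W)) (w : Sym2 W → ℕ)
    (hw : ∀ e ∈ F, 0 < w e) (nl : ∀ e ∈ F, ¬ e.IsDiag) (K : Finset W)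
    (hK : ∀ e ∈ F, ∀ x ∈ e, x ∈ K → e.toFinset ⊆ K)
    (hN : ∀ t, ∃ N ⊆ F, IsMt N ∧ (∀ Q ⊆ F, IsMt Q → ∑ e ∈ Q, w e ≤ ∑ e ∈ N, w e) ∧ ¬ CovV N t)
    (hconn : ∀ u ∈ K, ∀ v ∈ K, Relation.ReflTransGen (fun x y => s(x, y) ∈ F) u v)
    (M : Finset (Sym2 W)) (hM : OptM F w K M) :
    #K / 2 ≤ #(M.filter (fun e => e.toFinset ⊆ K)) := by
  by_contra hlt
  set Q := M.filter (fun e => e.toFinset ⊆ K) with hQ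
  have h1 : #(Q.biUnion Sym2.toFinset) ≤ #Q * 2 := by
    apply Finset.card_biUnion_le_card_mul
    intro e he
    exact (Sym2.card_toFinset_of_not_isDiag e (nl e (hM.1 (mem_filter.1 he).1))).le
  have h2 : 1 < #(K \ Q.biUnion Sym2.toFinset) := by
    have := Finset.le_card_sdiff (Q.biUnion Sym2.toFinset) K
    omega
  obtain ⟨u, hu, v, hv, huv⟩ := Finset.one_lt_card.1 h2
  have key : ∀ z ∈ K \ Q.biUnion Sym2.toFinset, ¬ CovV M z := by
    rintro z hz ⟨e, he, hze⟩
    rw [mem_sdiff] at hz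
    apply hz.2
    rw [mem_biUnion]
    exact ⟨e, mem_filter.2 ⟨he, hK e (hM.1 he) z hze hz.1⟩, Sym2.mem_toFinset.2 hze⟩
  exact no_two F w hw nl K hK hN u v (hconn u (mem_sdiff.1 hu).1 v (mem_sdiff.1 hv).1) M hM
    (mem_sdiff.1 hu).1 huv (key u hu) (key v hv)

lemma matching_bound {W : Type*} [Fintype W] [DecidableEq W] (E : Finset (Sym2 W))
    (nl : ∀ e ∈ E, ¬ e.IsDiag) (s : ℕ)
    (hdeg : ∀ v, #(E.filter (fun e => v ∈ e)) ≤ s)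
    (hodd : ∀ U : Finset W, #(E.filter (fun e => e.toFinset ⊆ U)) ≤ s * (#U / 2)) :
    ∀ (n : ℕ) (w : Sym2 W → ℕ), ∑ e ∈ E, w e = n →
      ∃ M ⊆ E, IsMt M ∧ ∑ e ∈ E, w e ≤ s * ∑ e ∈ M, w e := by
  classical
  intro n
  induction n using Nat.strong_induction_on with
  | _ n ih =>
  intro w hwn
  by_cases h0 : ∀ e ∈ E, w e = 0
  · exact ⟨∅, by simp, by simp [IsMt], by simp [Finset.sum_eq_zero h0]⟩
  push Not at h0
  obtain ⟨e0, he0, hwe0⟩ := h0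
  obtain ⟨F, hF⟩ : ∃ F, F = E.filter (fun e => 0 < w e) := ⟨_, rfl⟩
  have hFE : F ⊆ E := by rw [hF]; exact filter_subset _ _
  have hFw : ∀ e ∈ F, 0 < w e := by intro e he; rw [hF, mem_filter] at he; exact he.2
  have hFm : ∀ e ∈ E, 0 < w e → e ∈ F := by
    intro e he h; rw [hF, mem_filter]; exact ⟨he, h⟩
  obtain ⟨M0, hM0, hmax⟩ := Finset.exists_max_image (F.powerset.filter IsMt)
    (fun M => ∑ e ∈ M, w e) ⟨∅, by simp [IsMt]⟩
  simp only [mem_filter, mem_powerset] at hM0 hmax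
  -- a matching for a smaller weight may be taken inside F
  have hres : ∀ w' : Sym2 W → ℕ, (∀ e, w' e ≤ w e) → (∃ e ∈ E, w' e < w e) →
      ∃ M ⊆ F, IsMt M ∧ ∑ e ∈ E, w' e ≤ s * ∑ e ∈ M, w' e := by
    intro w' hle hlt
    obtain ⟨M, h1, h2, h3⟩ := ih (∑ e ∈ E, w' e)
      (by rw [← hwn]; exact Finset.sum_lt_sum (fun e _ => hle e) hlt) w' rfl
    refine ⟨M.filter (fun e => 0 < w' e), ?_, h2.subset (filter_subset _ _), ?_⟩
    · intro e he
      rw [mem_filter] at he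
      exact hFm e (h1 he.1) (he.2.trans_le (hle e))
    · rw [Finset.sum_filter_of_ne (fun e _ h => Nat.pos_of_ne_zero h)]
      exact h3
  refine ⟨M0, hM0.1.trans hFE, hM0.2, ?_⟩
  by_cases hc : ∃ v, ∀ N ⊆ F, IsMt N → (∀ Q ⊆ F, IsMt Q → ∑ e ∈ Q, w e ≤ ∑ e ∈ N, w e) →
      CovV N v
  · obtain ⟨v, hv⟩ := hc
    obtain ⟨e1, he1, hve1⟩ := hv M0 hM0.1 hM0.2 (fun Q h1 h2 => hmax Q ⟨h1, h2⟩)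
    obtain ⟨M, hMF, hM, hMs⟩ := hres (fun e => if v ∈ e then w e - 1 else w e)
      (by intro e; split_ifs <;> omega)
      ⟨e1, hFE (hM0.1 he1), by
        have := hFw e1 (hM0.1 he1)
        simp only [hve1, if_true]; omega⟩
    have h1 : ∑ e ∈ E, w e ≤ ∑ e ∈ E, (if v ∈ e then w e - 1 else w e) +
        #(E.filter (fun e => v ∈ e)) := by
      rw [Finset.card_filter, ← Finset.sum_add_distrib]
      apply Finset.sum_le_sum
      intro e _
      split_ifs <;> omega
    have h2 : ∑ e ∈ M, (if v ∈ e then w e - 1 else w e) + 1 ≤ ∑ e ∈ M0, w e := by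
      have h3 : ∑ e ∈ M, (if v ∈ e then w e - 1 else w e) ≤ ∑ e ∈ M, w e :=
        Finset.sum_le_sum (fun e _ => by split_ifs <;> omega)
      have h4 := hmax M ⟨hMF, hM⟩
      by_cases heq : ∑ e ∈ M, w e = ∑ e ∈ M0, w e
      · obtain ⟨e2, he2, hve2⟩ := hv M hMF hM (fun Q h1 h2 => by
          rw [heq]; exact hmax Q ⟨h1, h2⟩)
        have : ∑ e ∈ M, (if v ∈ e then w e - 1 else w e) < ∑ e ∈ M, w e :=
          Finset.sum_lt_sum (fun e _ => by split_ifs <;> omega)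
            ⟨e2, he2, by have := hFw e2 (hMF he2); simp only [hve2, if_true]; omega⟩
        omega
      · omega
    have h5 := hdeg v
    calc ∑ e ∈ E, w e ≤ s * ∑ e ∈ M, (if v ∈ e then w e - 1 else w e) + s := by omega
      _ = s * (∑ e ∈ M, (if v ∈ e then w e - 1 else w e) + 1) := by ring
      _ ≤ _ := Nat.mul_le_mul_left _ h2
  · push Not at hc
    have hN : ∀ t, ∃ N ⊆ F, IsMt N ∧
        (∀ Q ⊆ F, IsMt Q → ∑ e ∈ Q, w e ≤ ∑ e ∈ N, w e) ∧ ¬ CovV N t := by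
      intro t
      obtain ⟨N, h1, h2, h3, h4⟩ := hc t
      exact ⟨N, h1, h2, h3, h4⟩
    have he0F := hFm e0 he0 (Nat.pos_of_ne_zero hwe0)
    obtain ⟨a, ha⟩ : ∃ a, a ∈ e0 := ⟨_, Sym2.out_fst_mem e0⟩
    obtain ⟨K, hKdef⟩ : ∃ K : Finset W, K = Finset.univ.filter
      (fun z => Relation.ReflTransGen (fun x y => s(x, y) ∈ F) a z) := ⟨_, rfl⟩
    have hKm : ∀ z, z ∈ K ↔ Relation.ReflTransGen (fun x y => s(x, y) ∈ F) a z := by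
      intro z; rw [hKdef]; simp
    have hsy : Std.Symm (fun x y => s(x, y) ∈ F) := ⟨fun x y h => by rwa [Sym2.eq_swap]⟩
    have hsymm : ∀ x y, Relation.ReflTransGen (fun x y => s(x, y) ∈ F) x y →
        Relation.ReflTransGen (fun x y => s(x, y) ∈ F) y x :=
      fun x y h => (Relation.ReflTransGen.stdSymm (r := fun x y => s(x, y) ∈ F)).symm x y h
    have hK : ∀ e ∈ F, ∀ x ∈ e, x ∈ K → e.toFinset ⊆ K := by
      intro e he x hx hxK y hy
      rw [hKm] at hxK ⊢
      by_cases hxy : x = y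
      · rwa [← hxy]
      · have := ((Sym2.mem_and_mem_iff hxy).1 ⟨hx, Sym2.mem_toFinset.1 hy⟩)
        exact hxK.tail (by rw [← this]; exact he)
    have hconn : ∀ u ∈ K, ∀ v ∈ K, Relation.ReflTransGen (fun x y => s(x, y) ∈ F) u v := by
      intro u hu v hv
      rw [hKm] at hu hv
      exact (hsymm _ _ hu).trans hv
    have he0K : e0.toFinset ⊆ K := hK e0 he0F a ha ((hKm a).2 Relation.ReflTransGen.refl)
    obtain ⟨M, hMF, hM, hMs⟩ := hres (redw w K)
      (by intro e; unfold redw; split_ifs <;> omega)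
      ⟨e0, he0, by unfold redw; rw [if_pos he0K]; omega⟩
    obtain ⟨M1, hM1⟩ := exists_optM F w K
    have h1 := optM_card F w hFw (fun e he => nl e (hFE he)) K hK hN hconn M1 hM1
    have h2 := (hM1.2.2 M hMF hM).1
    have h3 := redw_sum w K M1 (fun e he => hFw e (hM1.1 he))
    have h4 := hmax M1 ⟨hM1.1, hM1.2.1⟩
    have h5 : ∑ e ∈ E, w e ≤ ∑ e ∈ E, redw w K e + #(E.filter (fun e => e.toFinset ⊆ K)) := by
      rw [Finset.card_filter, ← Finset.sum_add_distrib]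
      apply Finset.sum_le_sum
      intro e _
      unfold redw
      split_ifs <;> omega
    have h6 := hodd K
    calc ∑ e ∈ E, w e ≤ s * ∑ e ∈ M, redw w K e + s * (#K / 2) := by omega
      _ = s * (∑ e ∈ M, redw w K e + #K / 2) := by ring
      _ ≤ _ := Nat.mul_le_mul_left _ (by omega)

lemma perfect_bound {W : Type*} [Fintype W] [DecidableEq W] (E : Finset (Sym2 W))
    (nl : ∀ e ∈ E, ¬ e.IsDiag) (s : ℕ) (hs : 0 < s)
    (hdeg : ∀ v, #(E.filter (fun e => v ∈ e)) ≤ s)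
    (hodd : ∀ U : Finset W, #(E.filter (fun e => e.toFinset ⊆ U)) ≤ s * (#U / 2))
    (hE : 2 * #E = s * Fintype.card W) (w : Sym2 W → ℕ) :
    ∃ M ⊆ E, IsMt M ∧ 2 * #M = Fintype.card W ∧ ∑ e ∈ E, w e ≤ s * ∑ e ∈ M, w e := by
  obtain ⟨N, hN⟩ : ∃ N, N = 2 * ∑ e ∈ E, w e + 1 := ⟨_, rfl⟩
  obtain ⟨M, hME, hM, hs2⟩ := matching_bound E nl s hdeg hodd _ (fun e => w e + N) rfl
  have h1 : 2 * #M ≤ Fintype.card W :=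
    two_card_le M hM (fun e he => nl e (hME he)) Finset.univ (by simp)
  have h2 : ∑ e ∈ M, w e ≤ ∑ e ∈ E, w e := Finset.sum_le_sum_of_subset hME
  rw [Finset.sum_add_distrib, Finset.sum_add_distrib, Finset.sum_const, Finset.sum_const,
    smul_eq_mul, smul_eq_mul] at hs2
  have h3 : 2 * #M = Fintype.card W := by
    by_contra hne
    have h4 : 2 * #M + 1 ≤ Fintype.card W := by omega
    have h5 : s * N * (2 * #M + 1) ≤ s * N * Fintype.card W := Nat.mul_le_mul_left _ h4
    have h6 : s * ∑ e ∈ M, w e ≤ s * ∑ e ∈ E, w e := Nat.mul_le_mul_left _ h2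
    have h7 : s * N = 2 * (s * ∑ e ∈ E, w e) + s := by rw [hN]; ring
    have h8 : 2 * (#E * N) = s * N * Fintype.card W := by
      calc 2 * (#E * N) = (2 * #E) * N := by ring
        _ = _ := by rw [hE]; ring
    have h9 : s * (∑ e ∈ M, w e + #M * N) = s * ∑ e ∈ M, w e + s * N * #M := by ring
    have h10 : s * N * (2 * #M + 1) = 2 * (s * N * #M) + s * N := by ring
    omega
  refine ⟨M, hME, hM, h3, ?_⟩
  have h8 : 2 * (#E * N) = 2 * (s * N * #M) := by
    calc 2 * (#E * N) = (2 * #E) * N := by ring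
      _ = _ := by rw [hE, ← h3]; ring
  have h9 : s * (∑ e ∈ M, w e + #M * N) = s * ∑ e ∈ M, w e + s * N * #M := by ring
  omega

lemma perfect_bound_real {W : Type*} [Fintype W] [DecidableEq W] (E : Finset (Sym2 W))
    (nl : ∀ e ∈ E, ¬ e.IsDiag) (s : ℕ) (hs : 0 < s)
    (hdeg : ∀ v, #(E.filter (fun e => v ∈ e)) ≤ s)
    (hodd : ∀ U : Finset W, #(E.filter (fun e => e.toFinset ⊆ U)) ≤ s * (#U / 2))
    (hE : 2 * #E = s * Fintype.card W) (c : Sym2 W → ℝ) :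
    ∃ M ⊆ E, IsMt M ∧ 2 * #M = Fintype.card W ∧ ∑ e ∈ E, c e ≤ s * ∑ e ∈ M, c e := by
  classical
  obtain ⟨M0, h01, h02, h03, -⟩ := perfect_bound E nl s hs hdeg hodd hE (fun _ => 0)
  obtain ⟨M, hM, hmax⟩ := Finset.exists_max_image
    (E.powerset.filter (fun M => IsMt M ∧ 2 * #M = Fintype.card W))
    (fun M => (s : ℝ) * ∑ e ∈ M, c e) ⟨M0, by simp [h01, h02, h03]⟩
  simp only [mem_filter, mem_powerset] at hM hmax
  refine ⟨M, hM.1, hM.2.1, hM.2.2, ?_⟩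
  by_contra hlt
  push Not at hlt
  obtain ⟨δ, hδ⟩ : ∃ δ, δ = ∑ e ∈ E, c e - s * ∑ e ∈ M, c e := ⟨_, rfl⟩
  have hδ0 : 0 < δ := by linarith
  obtain ⟨B, hB⟩ : ∃ B : ℝ, ∀ e, 0 ≤ c e + B := by
    refine ⟨∑ e, |c e|, fun e => ?_⟩
    have := Finset.single_le_sum (f := fun e => |c e|) (fun i _ => abs_nonneg _)
      (Finset.mem_univ e)
    have := neg_abs_le (c e)
    linarith
  obtain ⟨n, hn⟩ := exists_nat_gt ((#E : ℝ) / δ)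
  rw [div_lt_iff₀ hδ0] at hn
  obtain ⟨Q, hQE, hQ, hQc, hQs⟩ := perfect_bound E nl s hs hdeg hodd hE
    (fun e => ⌊(n : ℝ) * (c e + B)⌋₊)
  have h1 : ∑ e ∈ E, ((n : ℝ) * (c e + B) - 1) ≤ ∑ e ∈ E, (⌊(n : ℝ) * (c e + B)⌋₊ : ℝ) :=
    Finset.sum_le_sum fun e _ => (Nat.sub_one_lt_floor _).le
  have h2 : ∑ e ∈ Q, (⌊(n : ℝ) * (c e + B)⌋₊ : ℝ) ≤ ∑ e ∈ Q, ((n : ℝ) * (c e + B)) :=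
    Finset.sum_le_sum fun e _ => Nat.floor_le (mul_nonneg (Nat.cast_nonneg _) (hB e))
  have h3 : ∑ e ∈ E, (⌊(n : ℝ) * (c e + B)⌋₊ : ℝ) ≤
      s * ∑ e ∈ Q, (⌊(n : ℝ) * (c e + B)⌋₊ : ℝ) := by exact_mod_cast hQs
  have h4 := mul_le_mul_of_nonneg_left h2 (Nat.cast_nonneg (α := ℝ) s)
  have h5 := hmax Q ⟨hQE, hQ, hQc⟩
  have h6 : (#E : ℝ) = s * #Q := by
    have : (2 * #E : ℝ) = s * (2 * #Q) := by
      rw [← hQc] at hE; exact_mod_cast hE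
    linarith
  rw [Finset.sum_sub_distrib, ← Finset.mul_sum, Finset.sum_add_distrib] at h1
  rw [← Finset.mul_sum, Finset.sum_add_distrib] at h4
  simp only [Finset.sum_const, nsmul_eq_mul, mul_one] at h1 h4
  have h7 : (s : ℝ) * (n * (∑ e ∈ Q, c e + #Q * B)) = n * (s * ∑ e ∈ Q, c e) + n * (#E * B) := by
    rw [h6]; ring
  have h8 : (n : ℝ) * (s * ∑ e ∈ Q, c e) ≤ n * (s * ∑ e ∈ M, c e) :=
    mul_le_mul_of_nonneg_left h5 (Nat.cast_nonneg _)
  have h9 : (n : ℝ) * δ = n * ∑ e ∈ E, c e - n * (s * ∑ e ∈ M, c e) := by rw [hδ]; ring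
  have h10 : (n : ℝ) * (∑ e ∈ E, c e + #E * B) = n * ∑ e ∈ E, c e + n * (#E * B) := by ring
  linarith

lemma double_count {W : Type*} [Fintype W] [DecidableEq W] (A : Finset (Sym2 W))
    (nl : ∀ e ∈ A, ¬ e.IsDiag) (U : Finset W) :
    ∑ v ∈ U, #(A.filter (fun e => v ∈ e)) =
      2 * #(A.filter (fun e => e.toFinset ⊆ U)) +
        #(A.filter (fun e => #(U ∩ e.toFinset) = 1)) := by
  have h1 : ∑ v ∈ U, #(A.filter (fun e => v ∈ e)) = ∑ e ∈ A, #(U.filter (fun v => v ∈ e)) := by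
    simp only [Finset.card_filter]
    exact Finset.sum_comm
  rw [h1, Finset.card_filter, Finset.card_filter, Finset.mul_sum, ← Finset.sum_add_distrib]
  apply Finset.sum_congr rfl
  intro e he
  have h2 : U.filter (fun v => v ∈ e) = U ∩ e.toFinset := by
    ext v; simp
  rw [h2]
  have h3 := Sym2.card_toFinset_of_not_isDiag e (nl e he)
  have h4 : #(U ∩ e.toFinset) ≤ #e.toFinset := Finset.card_le_card inter_subset_right
  have h5 : e.toFinset ⊆ U ↔ #(U ∩ e.toFinset) = 2 := by
    constructor
    · intro h; rw [Finset.inter_eq_right.2 h, h3]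
    · intro h
      exact Finset.inter_eq_right.1 (Finset.eq_of_subset_of_card_le inter_subset_right (by omega))
  simp only [h5]
  split_ifs <;> omega

lemma mem_convexHull_bound {W : Type*} [Fintype W] [DecidableEq W] (E : Finset (Sym2 W))
    (s : ℕ) (hs : 0 < s) (P : Finset (Finset (Sym2 W)))
    (h : ∀ c : Sym2 W → ℝ, ∃ M ∈ P, ∑ e ∈ E, c e ≤ s * ∑ e ∈ M, c e) :
    (fun e => if e ∈ E then (s : ℝ)⁻¹ else 0) ∈ convexHull ℝ
      ((P.image (fun M : Finset (Sym2 W) => fun e : Sym2 W => if e ∈ M then (1 : ℝ) else 0) :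
        Finset (Sym2 W → ℝ)) : Set (Sym2 W → ℝ)) := by
  by_contra hn
  obtain ⟨f, u, h1, h2⟩ := geometric_hahn_banach_closed_point (convex_convexHull ℝ _)
    ((Finset.finite_toSet _).isClosed_convexHull ℝ) hn
  have hf : ∀ y : Sym2 W → ℝ, f y = ∑ e, y e * f (Pi.single e 1) := by
    intro y
    have := LinearMap.pi_apply_eq_sum_univ (f : (Sym2 W → ℝ) →ₗ[ℝ] ℝ) y
    simp only [ContinuousLinearMap.coe_coe, smul_eq_mul] at this
    rw [this]
    apply Finset.sum_congr rfl
    intro e _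
    congr 2
    ext j
    simp [Pi.single_apply, eq_comm]
  obtain ⟨M, hM, hle⟩ := h (fun e => f (Pi.single e 1))
  have h3 := h1 _ (subset_convexHull ℝ _ (Finset.mem_coe.2 (Finset.mem_image_of_mem _ hM)))
  rw [hf] at h2 h3
  simp only [ite_mul, one_mul, zero_mul, Finset.sum_ite_mem, Finset.univ_inter] at h2 h3
  rw [← Finset.mul_sum] at h2
  have hs' : (0 : ℝ) < s := by exact_mod_cast hs
  have h4 : (s : ℝ)⁻¹ * ∑ e ∈ E, f (Pi.single e 1) ≤ ∑ e ∈ M, f (Pi.single e 1) := by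
    rw [inv_mul_le_iff₀ hs']; exact hle
  linarith

/-- for an `s`-regular graph `G` on an even (nonzero) number of
vertices, if `τ(PM(G)) ≥ s - 1` then `ν*(PM(G)) = s`. -/
theorem stmt17 {W : Type*} [Fintype W] [DecidableEq W] [Nonempty W]
    (G : SimpleGraph W) (s : ℕ)
    (hreg : ∀ v : W, (G.neighborSet v).ncard = s)
    (heven : Even (Fintype.card W))
    (hτ : ∀ c : Finset (Sym2 W), IsCoverH (PMG G) c → s - 1 ≤ c.card) :
    FracMatchNumIs (PMG G) (s : ℝ) := by
  classical
  have hdeg' : ∀ v, G.degree v = s := by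
    intro v
    rw [← hreg v, Set.ncard_eq_toFinset_card', ← G.card_neighborFinset_eq_degree]
    congr 1
  have hdeg : ∀ v, #(G.edgeFinset.filter (fun e => v ∈ e)) = s := by
    intro v
    rw [← hdeg' v, ← G.card_incidenceFinset_eq_degree, G.incidenceFinset_eq_filter]
  have nl : ∀ e ∈ G.edgeFinset, ¬ e.IsDiag := by
    intro e he
    exact G.not_isDiag_of_mem_edgeSet (SimpleGraph.mem_edgeFinset.1 he)
  constructor
  swap
  · intro f hf
    obtain ⟨v⟩ := ‹Nonempty W›
    have h1 : ∀ M, f M ≤ ∑ e ∈ G.edgeFinset.filter (fun e => v ∈ e), if e ∈ M then f M else 0 := by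
      intro M
      by_cases hM : M ∈ PMG G
      · obtain ⟨e, ⟨he, hve⟩, -⟩ := hM.2 v
        have h2 := Finset.single_le_sum (s := G.edgeFinset.filter (fun e => v ∈ e))
          (f := fun e => if e ∈ M then f M else 0)
          (fun i _ => by split_ifs; exacts [hf.1 M, le_rfl])
          (mem_filter.2 ⟨SimpleGraph.mem_edgeFinset.2 (hM.1 he), hve⟩)
        simpa [he] using h2
      · rw [hf.2.1 M hM]; simp
    calc ∑ M, f M ≤ ∑ M, ∑ e ∈ G.edgeFinset.filter (fun e => v ∈ e), if e ∈ M then f M else 0 :=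
          Finset.sum_le_sum fun M _ => h1 M
      _ = ∑ e ∈ G.edgeFinset.filter (fun e => v ∈ e), ∑ M, if e ∈ M then f M else 0 :=
          Finset.sum_comm
      _ ≤ ∑ e ∈ G.edgeFinset.filter (fun e => v ∈ e), 1 := by
          apply Finset.sum_le_sum
          intro e _
          rw [← Finset.sum_filter]
          exact hf.2.2 e
      _ = s := by rw [Finset.sum_const, hdeg v]; simp
  rcases Nat.eq_zero_or_pos s with rfl | hs
  · exact ⟨fun _ => 0, ⟨fun _ => le_rfl, fun _ _ => rfl, by simp⟩, by simp⟩
  have hodd : ∀ U : Finset W, #(G.edgeFinset.filter (fun e => e.toFinset ⊆ U)) ≤ s * (#U / 2) := by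
    intro U
    have h1 := double_count G.edgeFinset nl U
    rw [Finset.sum_congr rfl (fun v _ => hdeg v), Finset.sum_const, smul_eq_mul] at h1
    rcases Nat.even_or_odd' (#U) with ⟨k, hk | hk⟩
    · have h2 : #U / 2 = k := by omega
      rw [h2]
      have h3 : #U * s = 2 * (s * k) := by rw [hk]; ring
      omega
    · have h2 : #U / 2 = k := by omega
      rw [h2]
      have h3 : #U * s = 2 * (s * k) + s := by rw [hk]; ring
      have hcov : IsCoverH (PMG G) (G.edgeFinset.filter (fun e => #(U ∩ e.toFinset) = 1)) := by
        intro M hM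
        have hME : ∀ e ∈ M, e ∈ G.edgeFinset := fun e he => SimpleGraph.mem_edgeFinset.2 (hM.1 he)
        have h4 := double_count M (fun e he => nl e (hME e he)) U
        have h5 : ∀ v ∈ U, #(M.filter (fun e => v ∈ e)) = 1 := by
          intro v _
          obtain ⟨e, he, hu⟩ := hM.2 v
          rw [Finset.card_eq_one]
          refine ⟨e, ?_⟩
          ext e'
          rw [mem_filter, mem_singleton]
          constructor
          · exact fun h => hu e' h
          · rintro rfl; exact he
        rw [Finset.sum_congr rfl h5, Finset.sum_const, smul_eq_mul] at h4
        have h6 : 0 < #(M.filter (fun e => #(U ∩ e.toFinset) = 1)) := by omega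
        obtain ⟨e, he⟩ := Finset.card_pos.1 h6
        rw [mem_filter] at he
        exact ⟨e, mem_inter.2 ⟨mem_filter.2 ⟨hME e he.1, he.2⟩, he.1⟩⟩
      have h7 := hτ _ hcov
      omega
  have hE : 2 * #G.edgeFinset = s * Fintype.card W := by
    rw [← G.sum_degrees_eq_twice_card_edges, Finset.sum_congr rfl (fun v _ => hdeg' v),
      Finset.sum_const, smul_eq_mul, mul_comm, Finset.card_univ]
  have hull := mem_convexHull_bound G.edgeFinset s hs
    (Finset.univ.filter (fun M => M ∈ PMG G)) (by
      intro c
      obtain ⟨M, h1, h2, h3, h4⟩ := perfect_bound_real G.edgeFinset nl s hs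
        (fun v => (hdeg v).le) hodd hE c
      refine ⟨M, ?_, h4⟩
      rw [mem_filter]
      refine ⟨mem_univ _, fun e he => SimpleGraph.mem_edgeFinset.1 (h1 he), ?_⟩
      intro v
      have hc : CovV M v := by
        by_contra hc
        have := two_card_le M h2 (fun e he => nl e (h1 he)) (Finset.univ.erase v) (by
          intro e he x hx
          rw [mem_erase]
          refine ⟨?_, mem_univ _⟩
          rintro rfl
          exact hc ⟨e, he, hx⟩)
        rw [Finset.card_erase_of_mem (mem_univ v), Finset.card_univ] at this
        have := Fintype.card_pos_iff.2 ⟨v⟩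
        omega
      obtain ⟨e, he, hve⟩ := hc
      exact ⟨e, ⟨he, hve⟩, fun e' h => h2 e' h.1 e he v h.2 hve⟩)
  rw [Finset.mem_convexHull'] at hull
  obtain ⟨g, hg0, hg1, hg2⟩ := hull
  have hinj : Set.InjOn (fun M : Finset (Sym2 W) => fun e : Sym2 W => if e ∈ M then (1 : ℝ) else 0)
      (Finset.univ.filter (fun M => M ∈ PMG G) : Finset (Finset (Sym2 W))) := by
    intro M _ N _ h
    ext e
    have := congrFun h e
    by_cases h1 : e ∈ M <;> by_cases h2 : e ∈ N <;> simp_all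
  rw [Finset.sum_image hinj] at hg1 hg2
  have hs' : (0 : ℝ) < s := by exact_mod_cast hs
  refine ⟨fun M => if M ∈ PMG G then
    s * g (fun e : Sym2 W => if e ∈ M then (1 : ℝ) else 0) else 0, ⟨?_, ?_, ?_⟩, ?_⟩
  · intro M
    dsimp only
    split_ifs with h
    · refine mul_nonneg hs'.le (hg0 _ ?_)
      exact Finset.mem_image_of_mem _ (mem_filter.2 ⟨mem_univ _, h⟩)
    · exact le_rfl
  · intro M hM
    simp [hM]
  · intro e
    have h1 := congrFun hg2 e
    simp only [Finset.sum_apply, Pi.smul_apply, smul_eq_mul, mul_ite, mul_one, mul_zero] at h1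
    rw [Finset.sum_filter] at h1
    have h2 : ∑ M ∈ Finset.univ.filter (fun M : Finset (Sym2 W) => e ∈ M),
        (if M ∈ PMG G then s * g (fun e : Sym2 W => if e ∈ M then (1 : ℝ) else 0) else 0) =
        s * (if e ∈ G.edgeFinset then (s : ℝ)⁻¹ else 0) := by
      rw [← h1, Finset.sum_filter, Finset.mul_sum]
      apply Finset.sum_congr rfl
      intro M _
      split_ifs <;> simp
    rw [h2]
    split_ifs
    · rw [mul_inv_cancel₀ hs'.ne']
    · simp
  · rw [← Finset.sum_filter, ← Finset.mul_sum, hg1, mul_one]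
end
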